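/- Let n ≥ 3 be an integer, let Q₁ and Q₂ be mutually orthogonal rank-one orthogonal projections in M_n(ℂ), let Q₃ := I − Q₁ − Q₂, and let 𝒜 := ℂ(Q₁+Q₂) + Q₁·M_n(ℂ)·Q₂ + (Q₁+Q₂)·M_n(ℂ)·Q₃. If E is an idempotent in M_n(ℂ) such that EQ₁ = Q₁, then E𝒜E = {EAE : A ∈ 𝒜} is closed under multiplication (i.e., E𝒜E is an algebra). -/

import Mathlib

open Matrix

abbrev Mat (n : ℕ) := Matrix (Fin n) (Fin n) ℂ

/-- A set of matrices is closed under multiplication. -/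
def MulClosed {n : ℕ} (S : Set (Mat n)) : Prop :=
  ∀ x ∈ S, ∀ y ∈ S, x * y ∈ S

/-- The compression `E 𝒜 E = {E A E : A ∈ 𝒜}` of a set of matrices by `E`. -/
def compress {n : ℕ} (E : Mat n) (A : Set (Mat n)) : Set (Mat n) :=
  (fun M => E * M * E) '' A

/-- `𝒜` is projection compressible: for every orthogonal projection `P`,
`P 𝒜 P` is closed under multiplication. -/
def ProjectionCompressible {n : ℕ} (A : Set (Mat n)) : Prop :=
  ∀ P : Mat n, P * P = P → Pᴴ = P → MulClosed (compress P A)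

/-- `𝒜` is idempotent compressible: for every idempotent `E`,
`E 𝒜 E` is closed under multiplication. -/
def IdempotentCompressible {n : ℕ} (A : Set (Mat n)) : Prop :=
  ∀ E : Mat n, E * E = E → MulClosed (compress E A)

/-- A corner of the matrix algebra at a rank-one matrix is one-dimensional. -/
theorem exists_mul_mul_eq_smul_of_rank_eq_one {n : ℕ} {Q : Mat n} (hQ : Q.rank = 1)
    (X : Mat n) : ∃ c : ℂ, Q * X * Q = c • Q := by
  obtain ⟨u, -, hu⟩ := finrank_eq_one_iff'.1 hQ
  have hcol : ∀ w : Fin n → ℂ, ∃ c : ℂ, c • (u : Fin n → ℂ) = Q *ᵥ w := fun w => by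
    obtain ⟨c, hc⟩ := hu ⟨Q *ᵥ w, ⟨w, rfl⟩⟩
    exact ⟨c, congrArg Subtype.val hc⟩
  choose r hr using fun j => hcol (Pi.single j 1)
  have hQr : Q = vecMulVec u r := by
    ext i j
    have := congrFun (hr j) i
    simp only [mulVec_single_one, Pi.smul_apply, smul_eq_mul] at this
    rw [vecMulVec_apply, mul_comm, this]
    rfl
  refine ⟨r ⬝ᵥ (X *ᵥ u), ?_⟩
  generalize (u : Fin n → ℂ) = v at hQr ⊢
  rw [hQr, Matrix.mul_assoc, mul_vecMulVec, vecMulVec_mul_vecMulVec, vecMulVec_smul]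

open scoped ComplexOrder in
/-- If `Y * Q ≠ 0` for a rank-one orthogonal projection `Q`, then `Y` is left invertible
on the range of `Q`. -/
theorem exists_mul_mul_mul_eq_self {n : ℕ} {Q Y : Mat n} (hQr : Q.rank = 1) (hQ : Qᴴ = Q)
    (hY : Y * Q ≠ 0) : ∃ Z : Mat n, Q * Z * Y * Q = Q := by
  obtain ⟨c, hc⟩ := exists_mul_mul_eq_smul_of_rank_eq_one hQr (Yᴴ * Y)
  have hc0 : c ≠ 0 := by
    rintro rfl
    refine hY (conjTranspose_mul_self_eq_zero.1 ?_)
    rw [conjTranspose_mul, hQ]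
    simpa [Matrix.mul_assoc] using hc
  refine ⟨c⁻¹ • Yᴴ, ?_⟩
  calc Q * (c⁻¹ • Yᴴ) * Y * Q = c⁻¹ • (Q * (Yᴴ * Y) * Q) := by
        simp [Matrix.mul_assoc]
    _ = Q := by rw [hc, inv_smul_smul₀ hc0]

/-- Lemma 3.1.5: with `𝒜 = ℂ(Q₁+Q₂) + Q₁ Mₙ(ℂ) Q₂ + (Q₁+Q₂) Mₙ(ℂ) Q₃`, if `E` is an
idempotent such that `E Q₁ = Q₁`, then `E 𝒜 E` is an algebra. -/
theorem lemma_3_1_5 {n : ℕ} (hn : 3 ≤ n) (Q₁ Q₂ Q₃ : Mat n)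
    (hQ₁ : Q₁ * Q₁ = Q₁) (hQ₁' : Q₁ᴴ = Q₁) (hQ₁r : Q₁.rank = 1)
    (hQ₂ : Q₂ * Q₂ = Q₂) (hQ₂' : Q₂ᴴ = Q₂) (hQ₂r : Q₂.rank = 1)
    (horth : Q₁ * Q₂ = 0 ∧ Q₂ * Q₁ = 0)
    (hQ₃ : Q₃ = 1 - Q₁ - Q₂)
    (E : Mat n) (hE : E * E = E) (hEQ₁ : E * Q₁ = Q₁) :
    MulClosed (compress E {M : Mat n | ∃ (α : ℂ) (S T : Mat n), M = α • (Q₁ + Q₂) + Q₁ * S * Q₂ + (Q₁ + Q₂) * T * Q₃}) := by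
  obtain ⟨h12, h21⟩ := horth
  have h31 : Q₃ * Q₁ = 0 := by simp [hQ₃, sub_mul, hQ₁, h21]
  have h32 : Q₃ * Q₂ = 0 := by simp [hQ₃, sub_mul, hQ₂, h12]
  have hMQ₁ (α : ℂ) (S T : Mat n) :
      (α • (Q₁ + Q₂) + Q₁ * S * Q₂ + (Q₁ + Q₂) * T * Q₃) * Q₁ = α • Q₁ := by
    simp [add_mul, Matrix.mul_assoc, hQ₁, h21, h31]
  have hMQ₂ (α : ℂ) (S T : Mat n) :
      (α • (Q₁ + Q₂) + Q₁ * S * Q₂ + (Q₁ + Q₂) * T * Q₃) * Q₂ = α • Q₂ + Q₁ * S * Q₂ := by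
    simp [add_mul, Matrix.mul_assoc, hQ₂, h12, h32]
  have hPM (α : ℂ) (S T : Mat n) :
      (Q₁ + Q₂) * (α • (Q₁ + Q₂) + Q₁ * S * Q₂ + (Q₁ + Q₂) * T * Q₃) =
        α • (Q₁ + Q₂) + Q₁ * S * Q₂ + (Q₁ + Q₂) * T * Q₃ := by
    have hP : (Q₁ + Q₂) * (Q₁ + Q₂) = Q₁ + Q₂ := by
      simp [add_mul, mul_add, hQ₁, hQ₂, h12, h21]
    have hPQ₁ : (Q₁ + Q₂) * Q₁ = Q₁ := by simp [add_mul, hQ₁, h21]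
    simp only [mul_add (Q₁ + Q₂) (_ + _), mul_add (Q₁ + Q₂) (α • _), mul_smul_comm,
      ← Matrix.mul_assoc, hP, hPQ₁]
  rintro _ ⟨M, ⟨α, S, T, hM⟩, rfl⟩ _ ⟨N, ⟨β, S', T', hN⟩, rfl⟩
  obtain ⟨L, hL⟩ : ∃ L, L = M * E * N := ⟨_, rfl⟩
  have hMN : E * M * E * (E * N * E) = E * L * E := by
    calc E * M * E * (E * N * E) = E * M * (E * E) * N * E := by simp only [Matrix.mul_assoc]
      _ = E * L * E := by rw [hE, hL]; simp only [Matrix.mul_assoc]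
  have hM1 : M * Q₁ = α • Q₁ := hM ▸ hMQ₁ α S T
  have hM2 : M * Q₂ = α • Q₂ + Q₁ * S * Q₂ := hM ▸ hMQ₂ α S T
  have hN1 : N * Q₁ = β • Q₁ := hN ▸ hMQ₁ β S' T'
  have hN2 : N * Q₂ = β • Q₂ + Q₁ * S' * Q₂ := hN ▸ hMQ₂ β S' T'
  have hPL : (Q₁ + Q₂) * L = L := by
    rw [hL, ← Matrix.mul_assoc, ← Matrix.mul_assoc, show (Q₁ + Q₂) * M = M from hM ▸ hPM α S T]
  have hL1 : L * Q₁ = (α * β) • Q₁ := by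
    rw [hL, Matrix.mul_assoc, hN1, mul_smul_comm, Matrix.mul_assoc, hEQ₁, hM1, smul_smul,
      mul_comm]
  obtain ⟨δ, hδ⟩ := exists_mul_mul_eq_smul_of_rank_eq_one hQ₂r L
  have hdecomp : L = (α * β) • (Q₁ + Q₂) + Q₁ * L * Q₂ + (Q₁ + Q₂) * L * Q₃ +
      (δ - α * β) • Q₂ := by
    have h : L = L * Q₁ + (Q₁ + Q₂) * L * Q₂ + (Q₁ + Q₂) * L * Q₃ := by
      rw [hPL, hQ₃]; noncomm_ring
    rw [add_mul Q₁ Q₂ L, add_mul (Q₁ * L) (Q₂ * L) Q₂, hδ, hL1] at h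
    rw [add_mul Q₁ Q₂ L]
    conv_lhs => rw [h]
    module
  rw [hMN]
  by_cases hEQ₂ : E * Q₂ = Q₂
  · refine ⟨L, ⟨α * β, L, L, ?_⟩, rfl⟩
    have h : δ • Q₂ = (α * β) • Q₂ := by
      have hEN : E * (N * Q₂) = β • Q₂ + Q₁ * S' * Q₂ := by
        rw [hN2, mul_add, mul_smul_comm, hEQ₂, Matrix.mul_assoc Q₁, ← Matrix.mul_assoc E, hEQ₁]
      have hLQ₂ : L * Q₂ = β • (M * Q₂) + M * Q₁ * (S' * Q₂) := by
        rw [hL, Matrix.mul_assoc, Matrix.mul_assoc, hEN]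
        simp only [mul_add, mul_smul_comm, Matrix.mul_assoc]
      rw [← hδ, Matrix.mul_assoc, hLQ₂, hM1, hM2]
      simp [mul_add, ← Matrix.mul_assoc, h21, hQ₂, smul_smul, mul_comm]
    rw [sub_smul, h, sub_self, add_zero] at hdecomp
    exact hdecomp
  · obtain ⟨Z, hZ⟩ := exists_mul_mul_mul_eq_self (Y := 1 - E) hQ₂r hQ₂'
      (by rw [sub_mul, one_mul]; exact sub_ne_zero.2 (Ne.symm hEQ₂))
    obtain ⟨W, hW⟩ : ∃ W, W = Q₂ - Q₂ * Z * (1 - E) := ⟨_, rfl⟩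
    have hWE : W * E = Q₂ * E := by
      rw [hW, sub_mul, Matrix.mul_assoc (Q₂ * Z), sub_mul, one_mul, hE]; simp
    have hW1 : W * Q₁ = 0 := by
      rw [hW, sub_mul, Matrix.mul_assoc (Q₂ * Z), sub_mul, one_mul, hEQ₁, h21]; simp
    have hW2 : W * Q₂ = 0 := by rw [hW, sub_mul, hZ, hQ₂, sub_self]
    have hW3 : (Q₁ + Q₂) * W * Q₃ = W := by
      have hPW : (Q₁ + Q₂) * W = W := by
        rw [hW, mul_sub]; simp only [add_mul, ← Matrix.mul_assoc, h12, hQ₂]; simp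
      rw [hPW, hQ₃, mul_sub, mul_sub, hW1, hW2]; simp
    refine ⟨_, ⟨α * β, L, L + (δ - α * β) • W, rfl⟩, ?_⟩
    have h : (α * β) • (Q₁ + Q₂) + Q₁ * L * Q₂ + (Q₁ + Q₂) * (L + (δ - α * β) • W) * Q₃ =
        L + (δ - α * β) • (W - Q₂) := by
      conv_rhs => rw [hdecomp]
      rw [mul_add (Q₁ + Q₂) L, add_mul _ _ Q₃, mul_smul_comm, smul_mul_assoc, hW3]
      module
    beta_reduce
    rw [h, mul_add, add_mul, mul_smul_comm, smul_mul_assoc, Matrix.mul_assoc E (W - Q₂), sub_mul,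
      hWE]
    simp
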